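/- arXiv:2411.06169 — 6 statements merged into one kernel-verified Lean document; each statement's English description precedes it below -/
import Mathlib

section
/- Let A, B, C, D > 0 and let p, q, η be real numbers with 1 ≤ p < q < 2 < η. Define f : (0,∞) → ℝ by f(t) = (A t² − B t^η)/(C t^p + D t^q). Then there exists a unique t_n > 0 such that f(t_n) = sup_{t>0} f(t), and t_n is the unique critical point of f in (0,∞) (i.e., the unique t > 0 with f'(t) = 0). -/
/-- The derivative of `(A t² - B t^η) / (C t^p + D t^q)`, factored so that its sign is visible. -/
lemma hasDerivAt_fibering_quotient {A B C D p q η t : ℝ} (hC : 0 < C) (hD : 0 < D) (ht : 0 < t) :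
    HasDerivAt (fun t : ℝ => (A * t ^ (2 : ℝ) - B * t ^ η) / (C * t ^ p + D * t ^ q))
      (t * t ^ p / (C * t ^ p + D * t ^ q) ^ 2 *
        (A * (C * (2 - p) + D * (2 - q) * t ^ (q - p)) -
          B * t ^ (η - 2) * (C * (η - p) + D * (η - q) * t ^ (q - p)))) t := by
  have hden : C * t ^ p + D * t ^ q ≠ 0 := by positivity
  have hpow (r : ℝ) : HasDerivAt (fun t : ℝ => t ^ r) (r * t ^ (r - 1)) t :=
    Real.hasDerivAt_rpow_const (Or.inl ht.ne')
  have hquot := (((hpow 2).const_mul A).sub ((hpow η).const_mul B)).fun_div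
    (((hpow p).const_mul C).add ((hpow q).const_mul D)) hden
  refine hquot.congr_deriv ?_
  have hq : t ^ q = t ^ p * t ^ (q - p) := by
    rw [← Real.rpow_add ht]; congr 1; ring
  have hη : t ^ η = t ^ 2 * t ^ (η - 2) := by
    rw [← Real.rpow_natCast, ← Real.rpow_add ht]; congr 1; push_cast; ring
  simp only [Pi.add_apply, Pi.sub_apply, Real.rpow_sub_one ht.ne', Real.rpow_two]
  rw [div_mul_eq_mul_div]
  congr 1
  rw [hq, hη]
  field_simp
  ring

/-- If `(A * N - B * U * M)` is nonnegative at `t`, where `N` and `M` are the affine functions of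
`t ^ (q - p)` below and `U = t ^ (η - 2)`, then it is positive at every smaller point. -/
lemma fibering_factor_pos_of_lt {A B C D p q η s t : ℝ} (hA : 0 < A) (hB : 0 < B) (hC : 0 < C)
    (hD : 0 < D) (hpq : p < q) (hq : q < 2) (hη : 2 < η) (hs : 0 < s) (hst : s < t)
    (h : 0 ≤ A * (C * (2 - p) + D * (2 - q) * t ^ (q - p)) -
      B * t ^ (η - 2) * (C * (η - p) + D * (η - q) * t ^ (q - p))) :
    0 < A * (C * (2 - p) + D * (2 - q) * s ^ (q - p)) -
      B * s ^ (η - 2) * (C * (η - p) + D * (η - q) * s ^ (q - p)) := by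
  have hS : s ^ (q - p) < t ^ (q - p) := Real.rpow_lt_rpow hs.le hst (by linarith)
  have hU : s ^ (η - 2) < t ^ (η - 2) := Real.rpow_lt_rpow hs.le hst (by linarith)
  have hS0 : 0 < s ^ (q - p) := Real.rpow_pos_of_pos hs _
  generalize s ^ (q - p) = S at *
  generalize t ^ (q - p) = T at *
  generalize s ^ (η - 2) = U at *
  generalize t ^ (η - 2) = V at *
  have hM (x : ℝ) (hx : 0 < x) : 0 < C * (η - p) + D * (η - q) * x :=
    add_pos (mul_pos hC (by linarith)) (mul_pos (mul_pos hD (by linarith)) hx)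
  have hMS := hM S hS0
  have hMT := hM T (hS0.trans hS)
  have hcross : (C * (2 - p) + D * (2 - q) * S) * (C * (η - p) + D * (η - q) * T) -
      (C * (2 - p) + D * (2 - q) * T) * (C * (η - p) + D * (η - q) * S) =
      C * D * (η - 2) * (q - p) * (T - S) := by ring
  have hcross_pos : 0 < C * D * (η - 2) * (q - p) * (T - S) :=
    mul_pos (mul_pos (mul_pos (mul_pos hC hD) (by linarith)) (by linarith)) (by linarith)
  refine pos_of_mul_pos_left ?_ hMT.le
  have h1 := mul_nonneg h hMS.le
  have h2 := mul_pos hA hcross_pos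
  have h3 := mul_pos (mul_pos hB (sub_pos.2 hU)) (mul_pos hMS hMT)
  rw [← hcross] at h2
  linarith

/-- The sign-determining factor of the derivative has a positive zero. -/
lemma exists_fibering_factor_eq_zero {A B C D p q η : ℝ} (hA : 0 < A) (hB : 0 < B) (hC : 0 < C)
    (hD : 0 < D) (hpq : p < q) (hq : q < 2) (hη : 2 < η) :
    ∃ t : ℝ, 0 < t ∧ A * (C * (2 - p) + D * (2 - q) * t ^ (q - p)) -
      B * t ^ (η - 2) * (C * (η - p) + D * (η - q) * t ^ (q - p)) = 0 := by
  have h2p : 0 < 2 - p := by linarith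
  have h2q : 0 < 2 - q := by linarith
  have hηp : 0 < η - p := by linarith
  have hηq : 0 < η - q := by linarith
  have hη2 : 0 < η - 2 := by linarith
  have hroot (r : ℝ) (hr : 0 < r) : ∃ t : ℝ, 0 < t ∧ t ^ (η - 2) = r :=
    ⟨r ^ (η - 2)⁻¹, Real.rpow_pos_of_pos hr _, Real.rpow_inv_rpow hr.le hη2.ne'⟩
  obtain ⟨a, ha, hUa⟩ := hroot (A * (2 - q) / (B * (η - q))) (by positivity)
  obtain ⟨b, hb, hUb⟩ := hroot (A * (2 - p) / (B * (η - p))) (by positivity)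
  have hgap : 0 < (η - 2) * (q - p) := mul_pos hη2 (by linarith)
  have hab : a ≤ b := by
    rw [← Real.rpow_le_rpow_iff ha.le hb.le hη2, hUa, hUb, div_le_div_iff₀ (by positivity)
      (by positivity)]
    nlinarith [mul_pos (mul_pos hA hB) hgap]
  have hcont : ContinuousOn (fun t : ℝ => A * (C * (2 - p) + D * (2 - q) * t ^ (q - p)) -
      B * t ^ (η - 2) * (C * (η - p) + D * (η - q) * t ^ (q - p))) (Set.Icc a b) := by
    have hpow (r : ℝ) : ContinuousOn (fun t : ℝ => t ^ r) (Set.Icc a b) :=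
      continuousOn_id.rpow_const fun t ht => Or.inl (ha.trans_le ht.1).ne'
    have h1 := hpow (q - p)
    have h2 := hpow (η - 2)
    fun_prop
  have hzero : (0 : ℝ) ∈ (fun t : ℝ => A * (C * (2 - p) + D * (2 - q) * t ^ (q - p)) -
      B * t ^ (η - 2) * (C * (η - p) + D * (η - q) * t ^ (q - p))) '' Set.Icc a b := by
    refine intermediate_value_Icc' hab hcont ⟨?_, ?_⟩
    · have heq : A * (C * (2 - p) + D * (2 - q) * b ^ (q - p)) -
          B * b ^ (η - 2) * (C * (η - p) + D * (η - q) * b ^ (q - p)) =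
          -(A * D * b ^ (q - p) * ((η - 2) * (q - p)) / (η - p)) := by
        rw [hUb]; field_simp; ring
      simp only [heq]
      exact neg_nonpos.2 (by positivity)
    · have heq : A * (C * (2 - p) + D * (2 - q) * a ^ (q - p)) -
          B * a ^ (η - 2) * (C * (η - p) + D * (η - q) * a ^ (q - p)) =
          A * C * ((η - 2) * (q - p)) / (η - q) := by
        rw [hUa]; field_simp; ring
      simp only [heq]
      positivity
  obtain ⟨t, ht, h⟩ := hzero
  exact ⟨t, ha.trans_le ht.1, h⟩

/-- Lemma 5.2 (apendice Maxwell): the function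
`f(t) = (A t² − B t^η)/(C t^p + D t^q)` on `(0,∞)`, with `A,B,C,D > 0` and
`1 ≤ p < q < 2 < η`, has a unique global maximum point `t_n > 0` over `(0,∞)`,
which is moreover its unique critical point in `(0,∞)`. -/
theorem stmt_2 (A B C D p q η : ℝ) (hA : 0 < A) (hB : 0 < B) (hC : 0 < C) (hD : 0 < D)
    (hp : 1 ≤ p) (hpq : p < q) (hq : q < 2) (hη : 2 < η)
    (f : ℝ → ℝ)
    (hf : ∀ t : ℝ, f t = (A * t ^ (2 : ℝ) - B * t ^ η) / (C * t ^ p + D * t ^ q)) :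
    ∃! tn : ℝ, 0 < tn ∧ (∀ t : ℝ, 0 < t → f t ≤ f tn) ∧
      (∀ t : ℝ, 0 < t → (deriv f t = 0 ↔ t = tn)) := by
  obtain ⟨m, hm, hm0⟩ := exists_fibering_factor_eq_zero hA hB hC hD hpq hq hη
  have hderiv (t : ℝ) (ht : 0 < t) := hasDerivAt_fibering_quotient
    (A := A) (B := B) (p := p) (q := q) (η := η) hC hD ht
  rw [← funext hf] at hderiv
  have hweight (t : ℝ) (ht : 0 < t) : 0 < t * t ^ p / (C * t ^ p + D * t ^ q) ^ 2 := by
    positivity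
  have hpos (t : ℝ) (ht : 0 < t) (htm : t < m) : 0 < deriv f t := by
    rw [(hderiv t ht).deriv]
    exact mul_pos (hweight t ht)
      (fibering_factor_pos_of_lt hA hB hC hD hpq hq hη ht htm hm0.ge)
  have hneg (t : ℝ) (htm : m < t) : deriv f t < 0 := by
    have ht := hm.trans htm
    rw [(hderiv t ht).deriv]
    refine mul_neg_of_pos_of_neg (hweight t ht) ?_
    by_contra! h
    exact (fibering_factor_pos_of_lt hA hB hC hD hpq hq hη hm htm h).ne' hm0
  have hcrit : ∀ t : ℝ, 0 < t → (deriv f t = 0 ↔ t = m) := by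
    intro t ht
    constructor
    · intro h
      rcases lt_trichotomy t m with hlt | heq | hgt
      · exact absurd h (hpos t ht hlt).ne'
      · exact heq
      · exact absurd h (hneg t hgt).ne
    · rintro rfl
      rw [(hderiv t ht).deriv, hm0, mul_zero]
  have hcont (t : ℝ) (ht : 0 < t) : ContinuousAt f t := (hderiv t ht).continuousAt
  refine ⟨m, ⟨hm, fun t ht => ?_, hcrit⟩, fun y hy => ?_⟩
  · rcases le_total t m with htm | htm
    · refine (strictMonoOn_of_deriv_pos (convex_Icc t m)
        (fun x hx => (hcont x (ht.trans_le hx.1)).continuousWithinAt) fun x hx => ?_).monotoneOn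
        (Set.left_mem_Icc.2 htm) (Set.right_mem_Icc.2 htm) htm
      rw [interior_Icc] at hx
      exact hpos x (ht.trans hx.1) hx.2
    · refine (strictAntiOn_of_deriv_neg (convex_Icc m t)
        (fun x hx => (hcont x (hm.trans_le hx.1)).continuousWithinAt) fun x hx => ?_).antitoneOn
        (Set.left_mem_Icc.2 htm) (Set.right_mem_Icc.2 htm) htm
      rw [interior_Icc] at hx
      exact hneg x hx.1
  · exact ((hy.2.2 m hm).1 ((hcrit m hm).2 rfl)).symm
end

section
/- Let A, B, C, D > 0 and let p, q, η be real numbers with 1 ≤ p < q < 2 < η. Set g(t) = (p C t^p + q D t^q)/(C t^p + D t^q) and h(t) = (2A t² − η B t^η)/(A t² − B t^η). Then there exists a unique t ∈ (0, (2A/(η B))^{1/(η−2)}) such that h(t) = g(t). -/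
theorem strictAntiOn_mobius_of_lt {A η : ℝ} (hA : 0 < A) (hη : 2 < η) :
    StrictAntiOn (fun x : ℝ => (2 * A - η * x) / (A - x)) (Set.Iio A) := by
  intro x hx y hy hxy
  have hx' : 0 < A - x := sub_pos.2 hx
  have hy' : 0 < A - y := sub_pos.2 hy
  change (2 * A - η * y) / (A - y) < (2 * A - η * x) / (A - x)
  rw [div_lt_div_iff₀ hy' hx']
  nlinarith [mul_pos (mul_pos hA (sub_pos.2 hη)) (sub_pos.2 hxy)]

theorem strictMonoOn_weighted_mean {C p q : ℝ} (hC : 0 < C) (hpq : p < q) :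
    StrictMonoOn (fun y : ℝ => (p * C + q * y) / (C + y)) (Set.Ioi 0) := by
  intro x hx y hy hxy
  have hx' : 0 < C + x := add_pos hC hx
  have hy' : 0 < C + y := add_pos hC hy
  change (p * C + q * x) / (C + x) < (p * C + q * y) / (C + y)
  rw [div_lt_div_iff₀ hx' hy']
  nlinarith [mul_pos (mul_pos hC (sub_pos.2 hpq)) (sub_pos.2 hxy)]

/-- Final step of the proof of Lemma 5.2 (apendice Maxwell): for `A,B,C,D > 0`
and `1 ≤ p < q < 2 < η`, the functions
`g(t) = (pC t^p + qD t^q)/(C t^p + D t^q)` and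
`h(t) = (2A t² − η B t^η)/(A t² − B t^η)` intersect at exactly one point of the
interval `(0, (2A/(η B))^{1/(η−2)})`. -/
theorem stmt_6 (A B C D p q η : ℝ) (hA : 0 < A) (hB : 0 < B) (hC : 0 < C) (hD : 0 < D)
    (hp : 1 ≤ p) (hpq : p < q) (hq : q < 2) (hη : 2 < η)
    (g h : ℝ → ℝ)
    (hg : ∀ t : ℝ, g t = (p * C * t ^ p + q * D * t ^ q) / (C * t ^ p + D * t ^ q))
    (hh : ∀ t : ℝ, h t =
      (2 * A * t ^ (2 : ℝ) - η * B * t ^ η) / (A * t ^ (2 : ℝ) - B * t ^ η)) :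
    ∃! t : ℝ, 0 < t ∧ t < (2 * A / (η * B)) ^ ((1 : ℝ) / (η - 2)) ∧ h t = g t := by
  have hη0 : 0 < η - 2 := by linarith
  have hqp0 : 0 < q - p := by linarith
  have hK : 0 < 2 * A / (η * B) := by positivity
  set T : ℝ := (2 * A / (η * B)) ^ ((1 : ℝ) / (η - 2)) with hT
  have hT0 : 0 < T := Real.rpow_pos_of_pos hK _
  have hTx : η * (B * T ^ (η - 2)) = 2 * A := by
    rw [hT, ← Real.rpow_mul hK.le, one_div_mul_cancel hη0.ne', Real.rpow_one]
    field_simp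
  have hx_lt : ∀ {s t : ℝ}, 0 < s → s < t → B * s ^ (η - 2) < B * t ^ (η - 2) :=
    fun hs hst => mul_lt_mul_of_pos_left (Real.rpow_lt_rpow hs.le hst hη0) hB
  have hy_lt : ∀ {s t : ℝ}, 0 < s → s < t → D * s ^ (q - p) < D * t ^ (q - p) :=
    fun hs hst => mul_lt_mul_of_pos_left (Real.rpow_lt_rpow hs.le hst hqp0) hD
  have hTA : B * T ^ (η - 2) < A := by nlinarith [Real.rpow_pos_of_pos hT0 (η - 2)]
  have hy_pos : ∀ {t : ℝ}, 0 < t → 0 < D * t ^ (q - p) :=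
    fun ht => mul_pos hD (Real.rpow_pos_of_pos ht _)
  have hh' : ∀ {t : ℝ}, 0 < t →
      h t = (2 * A - η * (B * t ^ (η - 2))) / (A - B * t ^ (η - 2)) := by
    intro t ht
    have e : t ^ η = t ^ (2 : ℝ) * t ^ (η - 2) := by
      rw [← Real.rpow_add ht, add_sub_cancel]
    rw [hh, e, ← mul_div_mul_left (2 * A - η * _) (A - _) (Real.rpow_pos_of_pos ht 2).ne']
    congr 1 <;> ring
  have hg' : ∀ {t : ℝ}, 0 < t →
      g t = (p * C + q * (D * t ^ (q - p))) / (C + D * t ^ (q - p)) := by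
    intro t ht
    have e : t ^ q = t ^ p * t ^ (q - p) := by
      rw [← Real.rpow_add ht, add_sub_cancel]
    rw [hg, e, ← mul_div_mul_left (p * C + _) (C + _) (Real.rpow_pos_of_pos ht p).ne']
    congr 1 <;> ring
  have hanti : ∀ {s t : ℝ}, 0 < s → s < t → t < T → h t < h s := by
    intro s t hs hst htT
    have hlt := (hx_lt (hs.trans hst) htT).trans hTA
    rw [hh' hs, hh' (hs.trans hst)]
    exact strictAntiOn_mobius_of_lt hA hη ((hx_lt hs hst).trans hlt) hlt (hx_lt hs hst)
  have hmono : ∀ {s t : ℝ}, 0 < s → s < t → g s < g t := by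
    intro s t hs hst
    rw [hg' hs, hg' (hs.trans hst)]
    exact strictMonoOn_weighted_mean hC hpq (hy_pos hs) (hy_pos (hs.trans hst)) (hy_lt hs hst)
  let F : ℝ → ℝ := fun t =>
    (2 * A - η * (B * t ^ (η - 2))) * (C + D * t ^ (q - p)) -
      (p * C + q * (D * t ^ (q - p))) * (A - B * t ^ (η - 2))
  have hF : Continuous F := by
    have h1 : Continuous fun t : ℝ => t ^ (η - 2) := Real.continuous_rpow_const hη0.le
    have h2 : Continuous fun t : ℝ => t ^ (q - p) := Real.continuous_rpow_const hqp0.le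
    fun_prop
  have hF0 : 0 < F 0 := by
    simp only [F, Real.zero_rpow hη0.ne', Real.zero_rpow hqp0.ne']
    nlinarith [mul_pos (mul_pos hA hC) (show 0 < 2 - p by linarith)]
  have hFT : F T < 0 := by
    have hnum : 0 < p * C + q * (D * T ^ (q - p)) :=
      add_pos (mul_pos (by linarith) hC) (mul_pos (by linarith) (hy_pos hT0))
    simp only [F, hTx, sub_self, zero_mul, zero_sub]
    exact neg_neg_of_pos (mul_pos hnum (sub_pos.2 hTA))
  obtain ⟨t, ⟨ht0, htT⟩, ht⟩ :=
    intermediate_value_Ioo' hT0.le hF.continuousOn (Set.mem_Ioo.2 ⟨hFT, hF0⟩)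
  have hteq : h t = g t := by
    have h1 : 0 < A - B * t ^ (η - 2) := sub_pos.2 ((hx_lt ht0 htT).trans hTA)
    have h2 : 0 < C + D * t ^ (q - p) := add_pos hC (hy_pos ht0)
    rw [hh' ht0, hg' ht0, div_eq_div_iff h1.ne' h2.ne']
    exact sub_eq_zero.1 ht
  refine ⟨t, ⟨ht0, htT, hteq⟩, ?_⟩
  rintro s ⟨hs0, hsT, hseq⟩
  rcases lt_trichotomy s t with hst | hst | hst
  · linarith [hanti hs0 hst htT, hmono hs0 hst]
  · exact hst
  · linarith [hanti ht0 hst hsT, hmono ht0 hst]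
end

section
/- Let θ > 0 and let q, η be real with 1 < q < 2 < η. Then θ^{(q−2)/(η−2)} (η − 2)(η − q)^{−(η−q)/(η−2)} (2 − q)^{(2−q)/(η−2)} > q(η − 2) ((2 − q)η/θ)^{(2−q)/(η−2)} (1/(2(η − q)))^{(η−q)/(η−2)}. -/
/-- The weighted AM-GM inequality for `q < 2 < η`, whose weighted mean with weights proportional to
`η - 2` and `2 - q` is `2`, with the power of `q` normalized to one. -/
theorem mul_rpow_lt_two_rpow {q η : ℝ} (hq : 0 < q) (hq2 : q < 2) (hη : 2 < η) :
    q * η ^ ((2 - q) / (η - 2)) < 2 ^ ((η - q) / (η - 2)) := by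
  have hη2 : 0 < η - 2 := by linarith
  have hη0 : 0 < η := by linarith
  have hlogη := Real.log_lt_sub_one_of_pos (x := η / 2) (by positivity) (by linarith)
  have hlogq := Real.log_lt_sub_one_of_pos (x := q / 2) (by positivity) (by linarith)
  rw [Real.log_div (by positivity) two_ne_zero] at hlogη hlogq
  rw [← Real.log_lt_log_iff (by positivity) (by positivity),
    Real.log_mul (by positivity) (by positivity), Real.log_rpow hη0, Real.log_rpow two_pos,
    div_mul_eq_mul_div, div_mul_eq_mul_div, lt_div_iff₀ hη2, add_mul,
    div_mul_cancel₀ _ hη2.ne']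
  linarith [mul_lt_mul_of_pos_left hlogη (sub_pos.2 hq2), mul_lt_mul_of_pos_left hlogq hη2]


/-- Remark 2.5 of the paper: with `η = α+β`, `1 < q < 2 < η` and `θ > 0`, the
constant `C_{α,β,q,θ}` is strictly larger than `C̃_{α,β,q,θ}`:
`θ^{(q−2)/(η−2)}(η−2)(η−q)^{−(η−q)/(η−2)}(2−q)^{(2−q)/(η−2)}
  > q(η−2)((2−q)η/θ)^{(2−q)/(η−2)}(1/(2(η−q)))^{(η−q)/(η−2)}`. -/
theorem stmt_9 (θ q η : ℝ) (hθ : 0 < θ) (hq1 : 1 < q) (hq2 : q < 2) (hη : 2 < η) :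
    θ ^ ((q - 2) / (η - 2)) * (η - 2) * (η - q) ^ (-((η - q) / (η - 2))) *
      (2 - q) ^ ((2 - q) / (η - 2)) >
    q * (η - 2) * ((2 - q) * η / θ) ^ ((2 - q) / (η - 2)) *
      (1 / (2 * (η - q))) ^ ((η - q) / (η - 2)) := by
  have hη2 : 0 < η - 2 := by linarith
  have hηq : 0 < η - q := by linarith
  have h2q : 0 < 2 - q := by linarith
  have hη0 : 0 < η := by linarith
  have hkey := mul_rpow_lt_two_rpow (by linarith) hq2 hη
  have hneg : (q - 2) / (η - 2) = -((2 - q) / (η - 2)) := by ring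
  rw [hneg]
  generalize (2 - q) / (η - 2) = a at *
  generalize (η - q) / (η - 2) = b at *
  rw [Real.rpow_neg hθ.le, Real.rpow_neg hηq.le, Real.div_rpow (by positivity) hθ.le,
    Real.mul_rpow h2q.le hη0.le, Real.div_rpow zero_le_one (by positivity), Real.one_rpow,
    Real.mul_rpow zero_le_two hηq.le]
  have hpos : 0 < (η - 2) * (2 - q) ^ a / (θ ^ a * (η - q) ^ b) := by positivity
  have h2b : (0 : ℝ) < 2 ^ b := by positivity
  calc q * (η - 2) * ((2 - q) ^ a * η ^ a / θ ^ a) * (1 / (2 ^ b * (η - q) ^ b))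
      = q * η ^ a / 2 ^ b * ((η - 2) * (2 - q) ^ a / (θ ^ a * (η - q) ^ b)) := by
        field_simp
    _ < 1 * ((η - 2) * (2 - q) ^ a / (θ ^ a * (η - q) ^ b)) :=
        mul_lt_mul_of_pos_right ((div_lt_one h2b).2 hkey) hpos
    _ = (θ ^ a)⁻¹ * (η - 2) * ((η - q) ^ b)⁻¹ * (2 - q) ^ a := by
        field_simp
end

section
/- Let A, B, a, b > 0 and let p, q, η be real with 1 ≤ p ≤ q < 2 < η. Define, for t > 0, Q_n(t) = (A t² − B t^η)/(a t^p + b t^q) and Q_e(t) = ((1/2)A t² − (B/η) t^η)/((a/p) t^p + (b/q) t^q). Then for every t > 0, Q_n(t) − Q_e(t) = (t/(pq)) · ((q a t^p + p b t^q)/(a t^p + b t^q)) · Q_e'(t). -/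
/-- The derivative of `(c / r) * t ^ r` at a positive point is `c * t ^ r / t`. -/
theorem hasDerivAt_div_mul_rpow (c : ℝ) {r t : ℝ} (hr : r ≠ 0) (ht : 0 < t) :
    HasDerivAt (fun s : ℝ => (c / r) * s ^ r) (c * t ^ r / t) t := by
  refine ((Real.hasDerivAt_rpow_const (p := r) (Or.inl ht.ne')).const_mul (c / r)).congr_deriv ?_
  rw [Real.rpow_sub_one ht.ne']
  field_simp

/-- If `f' = N / t` and `g' = D / t` at `t`, then `N / D - f / g = t * (g / D) * (f / g)'`. -/
theorem div_sub_div_eq_mul_deriv_div {f g : ℝ → ℝ} {N D t : ℝ}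
    (hf : HasDerivAt f (N / t) t) (hg : HasDerivAt g (D / t) t)
    (ht : t ≠ 0) (hD : D ≠ 0) (hgt : g t ≠ 0) :
    N / D - f t / g t = t * (g t / D) * deriv (fun s => f s / g s) t := by
  rw [(hf.fun_div hg hgt).deriv]
  field_simp

/-- Proposition 2.8 (lema_naruprop) in abstract fibering form: with
`A, B, a, b > 0` and `1 ≤ p ≤ q < 2 < η`, for
`Q_n(t) = (A t² − B t^η)/(a t^p + b t^q)` and
`Q_e(t) = ((1/2)A t² − (B/η) t^η)/((a/p) t^p + (b/q) t^q)` one has, for `t > 0`,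
`Q_n(t) − Q_e(t) = (t/(pq))·((q a t^p + p b t^q)/(a t^p + b t^q))·Q_e'(t)`. -/
theorem stmt_10 (A B a b p q η : ℝ) (hA : 0 < A) (hB : 0 < B) (ha : 0 < a) (hb : 0 < b)
    (hp : 1 ≤ p) (hpq : p ≤ q) (hq : q < 2) (hη : 2 < η)
    (Qn Qe : ℝ → ℝ)
    (hQn : ∀ t : ℝ, Qn t = (A * t ^ (2 : ℝ) - B * t ^ η) / (a * t ^ p + b * t ^ q))
    (hQe : ∀ t : ℝ, Qe t =
      ((1 / 2) * A * t ^ (2 : ℝ) - (B / η) * t ^ η) / ((a / p) * t ^ p + (b / q) * t ^ q)) :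
    ∀ t : ℝ, 0 < t →
      Qn t - Qe t = (t / (p * q)) *
        ((q * a * t ^ p + p * b * t ^ q) / (a * t ^ p + b * t ^ q)) * deriv Qe t := by
  intro t ht
  have hp0 : 0 < p := by linarith
  have hq0 : 0 < q := by linarith
  have hη0 : 0 < η := by linarith
  have hD : 0 < a * t ^ p + b * t ^ q := by positivity
  have hg : 0 < (a / p) * t ^ p + (b / q) * t ^ q := by positivity
  have hfun : Qe = fun s => ((A / 2) * s ^ (2 : ℝ) - (B / η) * s ^ η) /
      ((a / p) * s ^ p + (b / q) * s ^ q) := by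
    funext s
    rw [hQe, one_div_mul_eq_div]
  have hnum := (hasDerivAt_div_mul_rpow A two_ne_zero ht).fun_sub
    (hasDerivAt_div_mul_rpow B hη0.ne' ht)
  have hden := (hasDerivAt_div_mul_rpow a hp0.ne' ht).fun_add
    (hasDerivAt_div_mul_rpow b hq0.ne' ht)
  rw [← sub_div] at hnum
  rw [← add_div] at hden
  rw [hQn, hfun]
  refine (div_sub_div_eq_mul_deriv_div hnum hden ht.ne' hD.ne' hg.ne').trans ?_
  congr 1
  field_simp
end

section
/- Let A, B, a, b > 0 and let p, q, η be real with 1 ≤ p ≤ q < 2 < η. Define Q_n(t) = (A t² − B t^η)/(a t^p + b t^q) and Q_e(t) = ((1/2)A t² − (B/η) t^η)/((a/p) t^p + (b/q) t^q) for t > 0. Then both Q_n and Q_e attain their suprema over (0,∞), and sup_{t>0} Q_n(t) > sup_{t>0} Q_e(t). -/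
/-- Near `0` the quotient `(A t² - B t^η)/(a t^p + b t^q)` with `p < 2` lies below any `ε > 0`. -/
lemma exists_fibering_quotient_lt {A B a b p q η ε : ℝ} (hB : 0 < B) (ha : 0 < a)
    (hb : 0 < b) (hp : p < 2) (hε : 0 < ε) :
    ∃ δ > 0, ∀ t, 0 < t → t < δ →
      (A * t ^ (2 : ℝ) - B * t ^ η) / (a * t ^ p + b * t ^ q) < ε := by
  have hlim : Filter.Tendsto (fun t : ℝ => A * t ^ (2 - p)) (nhds 0) (nhds (A * 0 ^ (2 - p))) :=
    ((Real.continuousAt_rpow_const 0 (2 - p) (Or.inr (by linarith))).const_mul A)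
  rw [Real.zero_rpow (by linarith), mul_zero] at hlim
  obtain ⟨δ, hδ, h⟩ := Metric.eventually_nhds_iff.mp
    (hlim.eventually (gt_mem_nhds (mul_pos hε ha)))
  refine ⟨δ, hδ, fun t ht htδ => ?_⟩
  have h1 : A * t ^ (2 - p) < ε * a := h (by rwa [Real.dist_eq, sub_zero, abs_of_pos ht])
  have htp : 0 < t ^ p := Real.rpow_pos_of_pos ht p
  have htq : 0 < t ^ q := Real.rpow_pos_of_pos ht q
  have htη : 0 < t ^ η := Real.rpow_pos_of_pos ht η
  have h2 : t ^ (2 : ℝ) = t ^ (2 - p) * t ^ p := by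
    rw [← Real.rpow_add ht]; congr 1; ring
  rw [div_lt_iff₀ (by positivity), h2]
  have h3 := mul_lt_mul_of_pos_right h1 htp
  have h4 : 0 < B * t ^ η := by positivity
  have h5 : 0 < ε * (b * t ^ q) := by positivity
  linarith

/-- The quotient `(A t² - B t^η)/(a t^p + b t^q)` attains a positive maximum on `(0, ∞)`. -/
lemma exists_isMax_fibering_quotient {A B a b p q η : ℝ} (hA : 0 < A) (hB : 0 < B) (ha : 0 < a)
    (hb : 0 < b) (hp : p < 2) (hη : 2 < η) (Q : ℝ → ℝ)
    (hQ : ∀ t, 0 < t → Q t = (A * t ^ (2 : ℝ) - B * t ^ η) / (a * t ^ p + b * t ^ q)) :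
    ∃ t, 0 < t ∧ 0 < Q t ∧ ∀ s, 0 < s → Q s ≤ Q t := by
  have hη' : 0 < η - 2 := by linarith
  have hnum : ∀ t : ℝ, 0 < t →
      A * t ^ (2 : ℝ) - B * t ^ η = t ^ (2 : ℝ) * (A - B * t ^ (η - 2)) := fun t ht => by
    have h : t ^ η = t ^ (2 : ℝ) * t ^ (η - 2) := by
      rw [← Real.rpow_add ht]; congr 1; ring
    rw [h]; ring
  have hden : ∀ t : ℝ, 0 < t → 0 < a * t ^ p + b * t ^ q := fun t ht => by
    have := Real.rpow_pos_of_pos ht p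
    have := Real.rpow_pos_of_pos ht q
    positivity
  obtain ⟨T, hT, hTη⟩ : ∃ T : ℝ, 0 < T ∧ T ^ (η - 2) = A / B :=
    ⟨(A / B) ^ (η - 2)⁻¹, by positivity, Real.rpow_inv_rpow (by positivity) hη'.ne'⟩
  have hhalf : 0 < Q (T / 2) := by
    rw [hQ _ (by positivity), hnum _ (by positivity)]
    have h1 : (T / 2) ^ (η - 2) < A / B :=
      hTη ▸ Real.rpow_lt_rpow (by positivity) (by linarith) hη'
    rw [lt_div_iff₀ hB] at h1
    exact div_pos (mul_pos (by positivity) (by linarith)) (hden _ (by positivity))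
  have hlarge : ∀ s, T ≤ s → Q s ≤ 0 := fun s hs => by
    have hs0 : 0 < s := hT.trans_le hs
    rw [hQ s hs0, hnum s hs0]
    have h1 : A / B ≤ s ^ (η - 2) := hTη ▸ Real.rpow_le_rpow hT.le hs hη'.le
    rw [div_le_iff₀ hB] at h1
    exact div_nonpos_of_nonpos_of_nonneg
      (mul_nonpos_of_nonneg_of_nonpos (by positivity) (by linarith)) (hden s hs0).le
  obtain ⟨δ, hδ, hsmall⟩ := exists_fibering_quotient_lt (A := A) (q := q) (η := η) hB ha hb hp hhalf
  have hmem : T / 2 ∈ Set.Icc (min δ (T / 2)) T :=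
    ⟨min_le_right _ _, by linarith⟩
  have hmin : 0 < min δ (T / 2) := lt_min hδ (by positivity)
  have hcont : ContinuousOn Q (Set.Icc (min δ (T / 2)) T) := by
    have hpow : ∀ r : ℝ, ContinuousOn (fun t : ℝ => t ^ r) (Set.Icc (min δ (T / 2)) T) :=
      fun r t ht => (Real.continuousAt_rpow_const t r
        (Or.inl (hmin.trans_le ht.1).ne')).continuousWithinAt
    refine ContinuousOn.congr (f := fun t : ℝ =>
      (A * t ^ (2 : ℝ) - B * t ^ η) / (a * t ^ p + b * t ^ q)) ?_
      (fun t ht => hQ t (hmin.trans_le ht.1))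
    exact (((hpow 2).const_mul A).sub ((hpow η).const_mul B)).div
      (((hpow p).const_mul a).add ((hpow q).const_mul b))
      (fun t ht => (hden t (hmin.trans_le ht.1)).ne')
  obtain ⟨t, ht, hmax⟩ := isCompact_Icc.exists_isMaxOn ⟨_, hmem⟩ hcont
  have hle : Q (T / 2) ≤ Q t := hmax hmem
  refine ⟨t, hmin.trans_le ht.1, hhalf.trans_le hle, fun s hs => ?_⟩
  rcases lt_or_ge s (min δ (T / 2)) with h | h
  · have := hsmall s hs (h.trans_le (min_le_left _ _))
    rw [← hQ s hs] at this
    exact this.le.trans hle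
  · rcases le_total s T with h' | h'
    · exact hmax ⟨h, h'⟩
    · exact (hlarge s h').trans (hhalf.le.trans hle)

/-- If `A t² - B t^η ≤ M (a t^p + b t^q)` for all `t > 0`, then the difference of the integrals of
both sides against `dt / t` is monotone on `(0, ∞)`. -/
lemma monotoneOn_fibering_primitive {A B a b p q η M : ℝ} (hp : p ≠ 0) (hq : q ≠ 0) (hη : η ≠ 0)
    (h : ∀ t : ℝ, 0 < t → A * t ^ (2 : ℝ) - B * t ^ η ≤ M * (a * t ^ p + b * t ^ q)) :
    MonotoneOn (fun t : ℝ => M * (a / p * t ^ p + b / q * t ^ q) -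
      (1 / 2 * A * t ^ (2 : ℝ) - B / η * t ^ η)) (Set.Ioi 0) := by
  have hder : ∀ t : ℝ, 0 < t → HasDerivAt (fun t : ℝ => M * (a / p * t ^ p + b / q * t ^ q) -
      (1 / 2 * A * t ^ (2 : ℝ) - B / η * t ^ η))
      ((M * (a * t ^ p + b * t ^ q) - (A * t ^ (2 : ℝ) - B * t ^ η)) / t) t := fun t ht => by
    have hpow : ∀ r : ℝ, HasDerivAt (fun t : ℝ => t ^ r) (r * (t ^ r / t)) t := fun r => by
      rw [← Real.rpow_sub_one ht.ne']
      exact Real.hasDerivAt_rpow_const (Or.inl ht.ne')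
    refine (((((hpow p).const_mul (a / p)).add ((hpow q).const_mul (b / q))).const_mul M).sub
      (((hpow 2).const_mul (1 / 2 * A)).sub ((hpow η).const_mul (B / η)))).congr_deriv ?_
    field_simp
  refine monotoneOn_of_deriv_nonneg (convex_Ioi 0)
    (fun t ht => (hder t ht).continuousAt.continuousWithinAt) ?_ ?_ <;> rw [interior_Ioi]
  · exact fun t ht => (hder t ht).differentiableAt.differentiableWithinAt
  · intro t ht
    rw [(hder t ht).deriv]
    exact div_nonneg (sub_nonneg.mpr (h t ht)) (le_of_lt ht)

/-- Abstract content of Proposition 2.25: with `A, B, a, b > 0` and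
`1 ≤ p ≤ q < 2 < η`, both fibering maps
`Q_n(t) = (A t² − B t^η)/(a t^p + b t^q)` and
`Q_e(t) = ((1/2)A t² − (B/η) t^η)/((a/p) t^p + (b/q) t^q)` attain their
suprema over `(0,∞)`, and `sup_{t>0} Q_n(t) > sup_{t>0} Q_e(t)`. -/
theorem stmt_12 (A B a b p q η : ℝ) (hA : 0 < A) (hB : 0 < B) (ha : 0 < a) (hb : 0 < b)
    (hp : 1 ≤ p) (hpq : p ≤ q) (hq : q < 2) (hη : 2 < η)
    (Qn Qe : ℝ → ℝ)
    (hQn : ∀ t : ℝ, Qn t = (A * t ^ (2 : ℝ) - B * t ^ η) / (a * t ^ p + b * t ^ q))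
    (hQe : ∀ t : ℝ, Qe t =
      ((1 / 2) * A * t ^ (2 : ℝ) - (B / η) * t ^ η) / ((a / p) * t ^ p + (b / q) * t ^ q)) :
    (∃ t ∈ Set.Ioi (0 : ℝ), ∀ s ∈ Set.Ioi (0 : ℝ), Qn s ≤ Qn t) ∧
    (∃ t ∈ Set.Ioi (0 : ℝ), ∀ s ∈ Set.Ioi (0 : ℝ), Qe s ≤ Qe t) ∧
    sSup (Qn '' Set.Ioi 0) > sSup (Qe '' Set.Ioi 0) := by
  have hp0 : 0 < p := by linarith
  have hq0 : 0 < q := by linarith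
  have hη0 : 0 < η := by linarith
  have hp2 : p < 2 := by linarith
  have hA' : 0 < 1 / 2 * A := by positivity
  have hB' : 0 < B / η := by positivity
  have ha' : 0 < a / p := by positivity
  have hb' : 0 < b / q := by positivity
  obtain ⟨u, hu, hQu, humax⟩ :=
    exists_isMax_fibering_quotient hA hB ha hb hp2 hη Qn (fun t _ => hQn t)
  obtain ⟨v, hv, -, hvmax⟩ :=
    exists_isMax_fibering_quotient hA' hB' ha' hb' hp2 hη Qe (fun t _ => hQe t)
  refine ⟨⟨u, hu, humax⟩, ⟨v, hv, hvmax⟩, ?_⟩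
  have hsn : sSup (Qn '' Set.Ioi 0) = Qn u :=
    IsGreatest.csSup_eq ⟨Set.mem_image_of_mem _ hu, by rintro _ ⟨s, hs, rfl⟩; exact humax s hs⟩
  have hse : sSup (Qe '' Set.Ioi 0) = Qe v :=
    IsGreatest.csSup_eq ⟨Set.mem_image_of_mem _ hv, by rintro _ ⟨s, hs, rfl⟩; exact hvmax s hs⟩
  rw [hsn, hse, gt_iff_lt]
  have hden : ∀ {c d t : ℝ}, 0 < c → 0 < d → 0 < t → 0 < c * t ^ p + d * t ^ q :=
    fun {_ _ t} hc hd ht => by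
      have := Real.rpow_pos_of_pos ht p
      have := Real.rpow_pos_of_pos ht q
      positivity
  have hmono := monotoneOn_fibering_primitive (A := A) (B := B) (a := a) (b := b) (M := Qn u)
    hp0.ne' hq0.ne' hη0.ne' (fun t ht => by
      have h := humax t ht
      rwa [hQn t, div_le_iff₀ (hden ha hb ht)] at h)
  obtain ⟨δ, hδ, hsmall⟩ :=
    exists_fibering_quotient_lt (A := 1 / 2 * A) (q := q) (η := η) hB' ha' hb' hp2 hQu
  have hmin : 0 < min δ v := lt_min hδ hv
  have hw : 0 < min δ v / 2 := by positivity
  have hlt := hsmall (min δ v / 2) hw (by linarith [min_le_left δ v])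
  rw [div_lt_iff₀ (hden ha' hb' hw)] at hlt
  have hle := hmono hw hv (by linarith [min_le_right δ v])
  rw [hQe v, div_lt_iff₀ (hden ha' hb' hv)]
  dsimp only at hle
  linarith
end

section
/- Let A, B, a, b > 0 and let p, q, η be real with 1 ≤ p ≤ q < 2 < η. Set Q_n(t) = (A t² − B t^η)/(a t^p + b t^q) and λ* = sup_{t>0} Q_n(t). Then for every λ ∈ (0, λ*) the equation Q_n(t) = λ has exactly two solutions t⁺ < t⁻ in (0, ∞), and they satisfy t⁺ < t_n < t⁻ where t_n is the unique maximizer of Q_n on (0,∞). -/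
/-- A continuous convex function that lies below `c` at `m`, but not at some point on either side
of `m`, takes the value `c` exactly twice: once on each side of `m`. -/
theorem ConvexOn.exists_two_eq_of_lt {g : ℝ → ℝ} (hg : ConvexOn ℝ Set.univ g)
    (hcont : Continuous g) {c l m r : ℝ} (hlm : l ≤ m) (hmr : m ≤ r) (hl : c ≤ g l)
    (hm : g m < c) (hr : c ≤ g r) :
    ∃ x y, x < m ∧ m < y ∧ g x = c ∧ g y = c ∧ ∀ z, g z = c → z = x ∨ z = y := by
  obtain ⟨x, hx, hgx⟩ := intermediate_value_Icc' hlm hcont.continuousOn ⟨hm.le, hl⟩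
  obtain ⟨y, hy, hgy⟩ := intermediate_value_Icc hmr hcont.continuousOn ⟨hm.le, hr⟩
  have ne_m : ∀ z, g z = c → z ≠ m := fun z hz h => by subst h; exact hm.ne hz
  have right : ∀ u v, m < u → u < v → g u = c → g v ≠ c := fun u v hmu huv hu hv =>
    (hg.lt_right_of_left_lt (Set.mem_univ m) (Set.mem_univ v)
      (by rw [openSegment_eq_Ioo (hmu.trans huv)]; exact ⟨hmu, huv⟩) (hu ▸ hm)).ne
      (hu.trans hv.symm)
  have left : ∀ u v, u < v → v < m → g u = c → g v ≠ c := fun u v huv hvm hu hv =>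
    (hg.lt_left_of_right_lt (Set.mem_univ u) (Set.mem_univ m)
      (by rw [openSegment_eq_Ioo (huv.trans hvm)]; exact ⟨huv, hvm⟩) (hv ▸ hm)).ne
      (hv.trans hu.symm)
  have hxm := lt_of_le_of_ne hx.2 (ne_m x hgx)
  have hmy := lt_of_le_of_ne hy.1 (ne_m y hgy).symm
  refine ⟨x, y, hxm, hmy, hgx, hgy, fun z hz => ?_⟩
  rcases lt_or_gt_of_ne (ne_m z hz) with h | h
  · left
    rcases lt_trichotomy z x with h' | h' | h'
    · exact absurd hgx (left z x h' hxm hz)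
    · exact h'
    · exact absurd hz (left x z h' h hgx)
  · right
    rcases lt_trichotomy z y with h' | h' | h'
    · exact absurd hgy (right z y h h' hz)
    · exact h'
    · exact absurd hz (right y z hmy h' hgy)

theorem convexOn_const_mul_exp_mul {C : ℝ} (hC : 0 ≤ C) (k : ℝ) :
    ConvexOn ℝ Set.univ fun s : ℝ => C * Real.exp (k * s) := by
  simpa [Function.comp_def] using (convexOn_exp.comp_linearMap (LinearMap.mulLeft ℝ k)).smul hC

theorem exists_const_mul_exp_mul_eq {A C k : ℝ} (hA : 0 < A) (hC : 0 < C) (hk : k ≠ 0) :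
    ∃ s : ℝ, C * Real.exp (k * s) = A :=
  ⟨Real.log (A / C) / k, by
    rw [mul_div_cancel₀ _ hk, Real.exp_log (div_pos hA hC), mul_div_cancel₀ _ hC.ne']⟩


/-- Remark 2.27 (lasqueira) together with part of Proposition 2.20: with
`A, B, a, b > 0` and `1 ≤ p ≤ q < 2 < η`, set
`Q_n(t) = (A t² − B t^η)/(a t^p + b t^q)` and `λ* = sup_{t>0} Q_n(t)`. If `t_n`
is the (unique) maximizer of `Q_n` on `(0,∞)`, then for every `λ ∈ (0, λ*)` the
equation `Q_n(t) = λ` has exactly two solutions `t⁺ < t⁻` in `(0,∞)`, and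
`t⁺ < t_n < t⁻`. -/
theorem stmt_17 (A B a b p q η : ℝ) (hA : 0 < A) (hB : 0 < B) (ha : 0 < a) (hb : 0 < b)
    (hp : 1 ≤ p) (hpq : p ≤ q) (hq : q < 2) (hη : 2 < η)
    (Qn : ℝ → ℝ)
    (hQn : ∀ t : ℝ, Qn t = (A * t ^ (2 : ℝ) - B * t ^ η) / (a * t ^ p + b * t ^ q))
    (tn : ℝ) (htn : 0 < tn) (hmax : ∀ t : ℝ, 0 < t → Qn t ≤ Qn tn)
    (lam : ℝ) (hlam0 : 0 < lam) (hlam : lam < sSup (Qn '' Set.Ioi 0)) :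
    ∃ tp tm : ℝ, 0 < tp ∧ tp < tn ∧ tn < tm ∧ Qn tp = lam ∧ Qn tm = lam ∧
      ∀ t : ℝ, 0 < t → Qn t = lam → (t = tp ∨ t = tm) := by
  have hlt : lam < Qn tn := hlam.trans_le <| csSup_le (Set.nonempty_Ioi.image Qn) <| by
    rintro _ ⟨t, ht, rfl⟩
    exact hmax t ht
  set g : ℝ → ℝ := fun s => B * Real.exp ((η - 2) * s) + lam * a * Real.exp ((p - 2) * s)
    + lam * b * Real.exp ((q - 2) * s) with hg
  have hconv : ConvexOn ℝ Set.univ g :=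
    ((convexOn_const_mul_exp_mul hB.le _).add
      (convexOn_const_mul_exp_mul (by positivity) _)).add
      (convexOn_const_mul_exp_mul (by positivity) _)
  have hcont : Continuous g := by fun_prop
  have hden : ∀ s, 0 < a * Real.exp s ^ p + b * Real.exp s ^ q := fun s => by positivity
  -- On the logarithmic scale `Qn = lam` becomes the level-set equation `g = A`.
  have hdiff : ∀ s, A * Real.exp s ^ (2 : ℝ) - B * Real.exp s ^ η
      - lam * (a * Real.exp s ^ p + b * Real.exp s ^ q) = Real.exp (2 * s) * (A - g s) := by
    intro s
    have hexp : ∀ k : ℝ, Real.exp s ^ k = Real.exp (2 * s) * Real.exp ((k - 2) * s) := fun k => by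
      rw [← Real.exp_mul, ← Real.exp_add]
      ring_nf
    rw [hexp 2, hexp η, hexp p, hexp q]
    simp only [hg, sub_self, zero_mul, Real.exp_zero]
    ring
  have heq : ∀ s, Qn (Real.exp s) = lam ↔ g s = A := fun s => by
    rw [hQn, div_eq_iff (hden s).ne', ← sub_eq_zero, hdiff, mul_eq_zero,
      or_iff_right (Real.exp_pos _).ne', sub_eq_zero, eq_comm]
  have hgm : g (Real.log tn) < A := by
    rw [← Real.exp_log htn, hQn, lt_div_iff₀ (hden _), ← sub_pos, hdiff,
      mul_pos_iff_of_pos_left (Real.exp_pos _), sub_pos] at hlt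
    exact hlt
  obtain ⟨r, hr⟩ := exists_const_mul_exp_mul_eq hA hB (sub_pos.2 hη).ne'
  obtain ⟨l, hl⟩ := exists_const_mul_exp_mul_eq hA (mul_pos hlam0 ha)
    (sub_neg.2 (hpq.trans_lt hq)).ne
  have hBpos : ∀ s, 0 < B * Real.exp ((η - 2) * s) := fun s => by positivity
  have hapos : ∀ s, 0 < lam * a * Real.exp ((p - 2) * s) := fun s => by positivity
  have hbpos : ∀ s, 0 < lam * b * Real.exp ((q - 2) * s) := fun s => by positivity
  have hmr : Real.log tn ≤ r := by
    have h : B * Real.exp ((η - 2) * Real.log tn) < B * Real.exp ((η - 2) * r) := by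
      linarith [hapos (Real.log tn), hbpos (Real.log tn)]
    exact (lt_of_mul_lt_mul_left (Real.exp_lt_exp.1 (lt_of_mul_lt_mul_left h hB.le))
      (sub_pos.2 hη).le).le
  have hlm : l ≤ Real.log tn := by
    have h : lam * a * Real.exp ((p - 2) * Real.log tn) < lam * a * Real.exp ((p - 2) * l) := by
      linarith [hBpos (Real.log tn), hbpos (Real.log tn)]
    have h' := Real.exp_lt_exp.1 (lt_of_mul_lt_mul_left h (mul_pos hlam0 ha).le)
    exact (lt_of_mul_lt_mul_of_nonpos_left h' (by linarith)).le
  obtain ⟨x, y, hx, hy, hgx, hgy, huniq⟩ := hconv.exists_two_eq_of_lt hcont hlm hmr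
    (by linarith [hBpos l, hbpos l]) hgm (by linarith [hapos r, hbpos r])
  refine ⟨Real.exp x, Real.exp y, Real.exp_pos x, (Real.lt_log_iff_exp_lt htn).1 hx,
    (Real.log_lt_iff_lt_exp htn).1 hy, (heq x).2 hgx, (heq y).2 hgy, fun t ht h => ?_⟩
  rw [← Real.exp_log ht] at h ⊢
  simpa only [Real.exp_eq_exp] using huniq _ ((heq _).1 h)
end
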